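/- Let $F : \mathcal{C} \to \mathbb{R}^{N}$ be a Lipschitz map defined on $\mathcal{C} = B_\rho(0) \cap \mathbb{R}^j_+ \subseteq \mathbb{R}^j$ with $F(0)=0$, and suppose there is a linear map $dF : \mathbb{R}^j \to \mathbb{R}^N$ such that $\lim_{\alpha \downarrow 0} F(\alpha\eta)/\alpha = dF(\eta)$ for every $\eta \in \mathbb{R}^j_+$, with the limit uniform over $\eta$ in bounded subsets of $\mathbb{R}^j_+$. If $dF(\mathbb{R}^j_+) = \mathbb{R}^N$, then $0$ is an interior point of $F(\mathcal{C})$. -/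

import Mathlib

open Set Filter Topology

namespace ConicOpen

open MeasureTheory

lemma det_interp {n : ℕ} (w : ℕ → ℝ) (hw : Function.Injective w) :
    ∃ c : ℕ → ℝ, (∑ i ∈ Finset.range (n+1), c i = 1) ∧
      ∀ A : EuclideanSpace ℝ (Fin n) →L[ℝ] EuclideanSpace ℝ (Fin n),
        (1 + A).det = ∑ i ∈ Finset.range (n+1), c i * (1 + w i • A).det := by
  classical
  refine ⟨fun i => (Lagrange.basis (Finset.range (n+1)) w i).eval 1, ?_, ?_⟩
  · rw [← Polynomial.eval_finsetSum, Lagrange.sum_basis hw.injOn (by simp)]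
    simp
  · intro A
    let b := (EuclideanSpace.basisFun (Fin n) ℝ).toBasis
    let M := LinearMap.toMatrix b b (A : EuclideanSpace ℝ (Fin n) →ₗ[ℝ] EuclideanSpace ℝ (Fin n))
    let p : Polynomial ℝ :=
      ((Polynomial.X : Polynomial ℝ) • M.map Polynomial.C + (1 : Matrix (Fin n) (Fin n) ℝ).map Polynomial.C).det
    have hp : ∀ t : ℝ, p.eval t = (1 + t • A).det := by
      intro t
      rw [ContinuousLinearMap.det, ← LinearMap.det_toMatrix b]
      simp only [p]
      rw [← Polynomial.coe_evalRingHom, RingHom.map_det]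
      congr 1
      ext i j
      simp [M, LinearMap.toMatrix_apply, Matrix.one_apply, b]
      by_cases h : i = j <;> simp [h, add_comm, mul_comm]
    have hdeg : p.degree < (Finset.range (n+1)).card := by
      have := Polynomial.natDegree_det_X_add_C_le M 1
      rw [Finset.card_range]
      refine lt_of_le_of_lt Polynomial.degree_le_natDegree ?_
      have h2 : p.natDegree ≤ n := this.trans_eq (Fintype.card_fin n)
      exact_mod_cast Nat.lt_succ_of_le h2
    have h1 := Lagrange.eq_interpolate (s := Finset.range (n+1)) (v := w) hw.injOn hdeg
    have h2 := hp 1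
    rw [one_smul] at h2
    rw [← h2]
    conv_lhs => rw [h1]
    rw [Lagrange.interpolate_apply, Polynomial.eval_finsetSum]
    refine Finset.sum_congr rfl fun i _ => ?_
    rw [Polynomial.eval_mul, Polynomial.eval_C, hp, mul_comm]

/-- No Lipschitz retraction onto the sphere. -/
lemma no_retraction {n : ℕ} (h : EuclideanSpace ℝ (Fin n) → EuclideanSpace ℝ (Fin n))
    (L : NNReal) (hL : LipschitzWith L h) (h0 : ∀ x, 1 ≤ ‖x‖ → h x = 0)
    (h1 : ∀ x, ‖x‖ < 1 → ‖x + h x‖ = 1) : False := by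
  let E := EuclideanSpace ℝ (Fin n)
  let μ : Measure E := Measure.hausdorffMeasure (Module.finrank ℝ E)
  have : μ.IsAddHaarMeasure := MeasureTheory.isAddHaarMeasure_hausdorffMeasure
  let B : Set E := Metric.ball 0 1
  let S : Set E := B ∩ {x | DifferentiableAt ℝ h x}
  have hS : MeasurableSet S := measurableSet_ball.inter (measurableSet_of_differentiableAt ℝ h)
  have hBS : μ (B \ S) = 0 := by
    refine measure_mono_null ?_ (hL.ae_differentiableAt (μ := μ))
    intro x hx hd
    exact hx.2 ⟨hx.1, hd⟩
  obtain ⟨δ, hδ, hdet⟩ : ∃ δ > 0, ∀ A : E →L[ℝ] E, ‖A‖ < δ → 0 < (1 + A).det := by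
    have hc : Continuous fun A : E →L[ℝ] E => (1 + A).det :=
      ContinuousLinearMap.continuous_det.comp (continuous_const.add continuous_id)
    have h3 : (fun A : E →L[ℝ] E => (1 + A).det) 0 = 1 := by
      simp [ContinuousLinearMap.det]
    have := hc.continuousAt.eventually (lt_mem_nhds (a := 0) (by rw [h3]; norm_num))
    obtain ⟨δ, hδ, hh⟩ := Metric.eventually_nhds_iff.1 this
    exact ⟨δ, hδ, fun A hA => hh (by simpa [dist_eq_norm] using hA)⟩
  have hBpos : 0 < μ.real B := by
    have h4 : 0 < μ B := Metric.measure_ball_pos μ 0 one_pos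
    exact ENNReal.toReal_pos h4.ne' measure_ball_lt_top.ne
  have key : ∀ t : ℝ, 0 < t → t * L < 1 → t * L < δ →
      ∫ x in S, (1 + t • fderiv ℝ h x).det ∂μ = μ.real B := by
    intro t ht ht1 htδ
    let φ : E → E := fun x => x + t • h x
    have hinj : Function.Injective φ := by
      intro x y hxy
      have e : x - y = t • (h y - h x) := by
        simp only [φ] at hxy
        rw [smul_sub, sub_eq_sub_iff_add_eq_add, hxy]; abel
      have h5 : ‖x - y‖ ≤ t * L * ‖x - y‖ := by
        conv_lhs => rw [e]
        rw [norm_smul, Real.norm_of_nonneg ht.le, mul_assoc, norm_sub_rev x y]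
        gcongr
        simpa [dist_eq_norm] using hL.dist_le_mul y x
      have : ‖x - y‖ = 0 := by
        by_contra hne
        have : 0 < ‖x - y‖ := lt_of_le_of_ne (norm_nonneg _) (Ne.symm hne)
        nlinarith
      exact sub_eq_zero.1 (norm_eq_zero.1 this)
    have hsurj : Function.Surjective φ := by
      intro y
      have hcon : ContractingWith (t.toNNReal * L) (fun x => y - t • h x) := by
        constructor
        · rw [← NNReal.coe_lt_coe]; simpa [ht.le] using ht1
        · apply LipschitzWith.of_dist_le_mul
          intro a b
          have := hL.dist_le_mul a b
          rw [dist_eq_norm] at this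
          rw [dist_eq_norm, sub_sub_sub_cancel_left, ← smul_sub, norm_smul, norm_sub_rev,
            Real.norm_of_nonneg ht.le]
          push_cast
          rw [Real.coe_toNNReal _ ht.le, mul_assoc]
          gcongr
      have := hcon.fixedPoint_isFixedPt
      refine ⟨hcon.fixedPoint, ?_⟩
      have h6 : y - t • h hcon.fixedPoint = hcon.fixedPoint := this
      simp only [φ]
      nth_rewrite 1 [← h6]
      abel
    have hfix : ∀ x, x ∉ B → φ x = x := by
      intro x hx
      simp only [φ]
      rw [h0 x (by simpa [B] using hx)]; simp
    have himg : φ '' B = B := by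
      ext y
      constructor
      · rintro ⟨x, hx, rfl⟩
        by_contra hy
        have := hinj (hfix _ hy)
        rw [this] at hy
        exact hy hx
      · intro hy
        obtain ⟨x, rfl⟩ := hsurj y
        refine ⟨x, ?_, rfl⟩
        by_contra hx
        rw [hfix x hx] at hy
        exact hx hy
    have hφL : LipschitzWith (1 + t.toNNReal * L) φ := by
      apply LipschitzWith.of_dist_le_mul
      intro a b
      have := hL.dist_le_mul a b
      calc dist (φ a) (φ b) ≤ dist a b + dist (t • h a) (t • h b) := dist_add_add_le _ _ _ _
        _ = dist a b + t * dist (h a) (h b) := by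
            rw [dist_smul₀, Real.norm_of_nonneg ht.le]
        _ ≤ dist a b + t * (L * dist a b) := by gcongr
        _ = _ := by push_cast; rw [Real.coe_toNNReal _ ht.le]; ring
    have hnull : μ (φ '' (B \ S)) = 0 := by
      have := hφL.hausdorffMeasure_image_le (d := (Module.finrank ℝ E : ℝ)) (by positivity) (B \ S)
      have h7 : μ (φ '' (B \ S)) ≤ _ * μ (B \ S) := this
      rw [hBS, mul_zero] at h7
      exact nonpos_iff_eq_zero.1 h7
    have hm : μ (φ '' S) = μ B := by
      apply le_antisymm
      · conv_rhs => rw [← himg]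
        exact measure_mono (image_mono inter_subset_left)
      · calc μ B = μ (φ '' B) := by rw [himg]
          _ ≤ μ (φ '' S ∪ φ '' (B \ S)) := by
              apply measure_mono
              rw [← image_union]
              apply image_mono
              intro x hx
              by_cases hxs : x ∈ S
              · exact Or.inl hxs
              · exact Or.inr ⟨hx, hxs⟩
          _ ≤ _ := measure_union_le _ _
          _ = _ := by rw [hnull, add_zero]
    have hder : ∀ x ∈ S, HasFDerivWithinAt φ (1 + t • fderiv ℝ h x) S x := by
      intro x hx
      exact ((hasFDerivAt_id x).add (hx.2.hasFDerivAt.const_smul t)).hasFDerivWithinAt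
    have := integral_image_eq_integral_abs_det_fderiv_smul μ hS hder hinj.injOn (fun _ => (1:ℝ))
    simp only [smul_eq_mul, mul_one] at this
    rw [setIntegral_const, smul_eq_mul, mul_one, measureReal_def, hm] at this
    rw [measureReal_def, this]
    refine setIntegral_congr_fun hS fun x _ => ?_
    refine (abs_of_pos (hdet _ ?_)).symm
    rw [norm_smul, Real.norm_of_nonneg ht.le]
    refine lt_of_le_of_lt ?_ htδ
    gcongr
    exact norm_fderiv_le_of_lipschitz ℝ hL
  -- nodes
  let r : ℝ := min 1 δ / (L + 1)
  have hLnn : (0:ℝ) ≤ L := L.2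
  have hr : 0 < r := by positivity
  have hrL : r * L < min 1 δ := by
    have : 0 < min 1 δ := by positivity
    have e : r * (L + 1) = min 1 δ := by simp only [r]; field_simp
    nlinarith
  let w : ℕ → ℝ := fun i => r / (i + 1)
  have hw : Function.Injective w := by
    intro i j hij
    simp only [w] at hij
    field_simp at hij
    have : (i:ℝ) = j := by linarith
    exact_mod_cast this
  have hw0 : ∀ i, 0 < w i := fun i => by simp only [w]; positivity
  have hwr : ∀ i, w i ≤ r := fun i => div_le_self hr.le (by linarith [i.cast_nonneg (α := ℝ)])
  have hwL : ∀ i, w i * L < min 1 δ := fun i =>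
    lt_of_le_of_lt (mul_le_mul_of_nonneg_right (hwr i) hLnn) hrL
  have keyw : ∀ i, ∫ x in S, (1 + w i • fderiv ℝ h x).det ∂μ = μ.real B := fun i =>
    key _ (hw0 i) ((hwL i).trans_le (min_le_left _ _)) ((hwL i).trans_le (min_le_right _ _))
  obtain ⟨c, hc1, hc2⟩ := det_interp (n := n) w hw
  have hint : ∫ x in S, (1 + fderiv ℝ h x).det ∂μ = μ.real B := by
    have hfun : (fun x => (1 + fderiv ℝ h x).det) = fun x =>
        ∑ i ∈ Finset.range (n+1), c i * (1 + w i • fderiv ℝ h x).det := funext fun x => hc2 _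
    rw [hfun]
    rw [integral_finsetSum]
    · simp_rw [integral_const_mul, keyw]
      rw [← Finset.sum_mul, hc1, one_mul]
    · intro i _
      refine Integrable.const_mul ?_ _
      exact Integrable.of_integral_ne_zero (by rw [keyw]; exact hBpos.ne')
  have hzero : ∫ x in S, (1 + fderiv ℝ h x).det ∂μ = 0 := by
    apply setIntegral_eq_zero_of_forall_eq_zero
    intro x hx
    by_contra hne
    have hd : HasFDerivAt (fun y => y + h y) (1 + fderiv ℝ h x) x :=
      (hasFDerivAt_id x).add hx.2.hasFDerivAt
    have hsq := hd.norm_sq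
    have hconst : (fun y => ‖y + h y‖ ^ 2) =ᶠ[𝓝 x] fun _ => (1:ℝ) := by
      filter_upwards [Metric.isOpen_ball.mem_nhds hx.1] with y hy
      rw [h1 y (by simpa using hy)]; norm_num
    have hz := (hsq.congr_of_eventuallyEq hconst.symm).unique (hasFDerivAt_const (1:ℝ) x)
    let T := LinearMap.equivOfDetNeZero ((1 + fderiv ℝ h x : E →L[ℝ] E) : E →ₗ[ℝ] E) hne
    have hv : (1 + fderiv ℝ h x) (T.symm (x + h x)) = x + h x := T.apply_symm_apply (x + h x)
    have := congrArg (fun l => l (T.symm (x + h x))) hz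
    simp only [smul_apply, ContinuousLinearMap.comp_apply, hv] at this
    have hn := h1 x (by simpa [B] using hx.1)
    rw [innerSL_apply_apply, real_inner_self_eq_norm_sq, hn] at this
    norm_num at this
  rw [hint] at hzero
  exact hBpos.ne' hzero

lemma lip_smul {E : Type*} [NormedAddCommGroup E] [NormedSpace ℝ E] (s : Set E)
    (a : E → ℝ) (u : E → E) (A Ma U Mu : ℝ)
    (ha : ∀ x ∈ s, ∀ y ∈ s, |a x - a y| ≤ A * ‖x - y‖) (hMa : ∀ x ∈ s, |a x| ≤ Ma)
    (hu : ∀ x ∈ s, ∀ y ∈ s, ‖u x - u y‖ ≤ U * ‖x - y‖) (hMu : ∀ x ∈ s, ‖u x‖ ≤ Mu) :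
    ∀ x ∈ s, ∀ y ∈ s, ‖a x • u x - a y • u y‖ ≤ (Ma * U + A * Mu) * ‖x - y‖ := by
  intro x hx y hy
  have e : a x • u x - a y • u y = a x • (u x - u y) + (a x - a y) • u y := by
    rw [smul_sub, sub_smul]; abel
  rw [e]
  calc _ ≤ ‖a x • (u x - u y)‖ + ‖(a x - a y) • u y‖ := norm_add_le _ _
    _ = |a x| * ‖u x - u y‖ + |a x - a y| * ‖u y‖ := by
      rw [norm_smul, norm_smul, Real.norm_eq_abs, Real.norm_eq_abs]
    _ ≤ Ma * (U * ‖x - y‖) + (A * ‖x - y‖) * Mu := by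
      have h1 := hMa x hx
      have h2 := hu x hx y hy
      have h3 := ha x hx y hy
      have h4 := hMu y hy
      have h5 : 0 ≤ Ma := (abs_nonneg _).trans h1
      have h6 : 0 ≤ A * ‖x - y‖ := (abs_nonneg _).trans h3
      gcongr
    _ = _ := by ring

/-- A Lipschitz map of the unit ball that is uniformly close to the identity has a zero. -/
lemma exists_zero {n : ℕ} (f : EuclideanSpace ℝ (Fin n) → EuclideanSpace ℝ (Fin n)) (K : ℝ)
    (hf : ∀ x, ‖x‖ ≤ 1 → ∀ y, ‖y‖ ≤ 1 → ‖f x - f y‖ ≤ K * ‖x - y‖)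
    (hclose : ∀ x, ‖x‖ ≤ 1 → ‖f x - x‖ ≤ 1 / 4) : ∃ x, ‖x‖ ≤ 1 ∧ f x = 0 := by
  by_contra hno
  push Not at hno
  let s : Set (EuclideanSpace ℝ (Fin n)) := {x | ‖x‖ ≤ 1}
  have hs : IsCompact s := by
    have : s = Metric.closedBall 0 1 := by ext; simp [s]
    rw [this]; exact isCompact_closedBall 0 1
  let χ : EuclideanSpace ℝ (Fin n) → ℝ := fun x => min 1 (2 - 2 * ‖x‖)
  have hχ0 : ∀ x ∈ s, 0 ≤ χ x := fun x hx => le_min zero_le_one (by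
    have : ‖x‖ ≤ 1 := hx
    linarith)
  have hχ1 : ∀ x ∈ s, |χ x| ≤ 1 := fun x hx => by
    rw [abs_of_nonneg (hχ0 x hx)]; exact min_le_left _ _
  have hχL : ∀ x ∈ s, ∀ y ∈ s, |χ x - χ y| ≤ 2 * ‖x - y‖ := by
    intro x _ y _
    have h1 := abs_min_sub_min_le_max 1 (2 - 2 * ‖x‖) 1 (2 - 2 * ‖y‖)
    refine h1.trans (max_le (by simp) ?_)
    have h2 := abs_norm_sub_norm_le y x
    rw [norm_sub_rev] at h2
    have e : 2 - 2 * ‖x‖ - (2 - 2 * ‖y‖) = 2 * (‖y‖ - ‖x‖) := by ring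
    rw [e, abs_mul, abs_two]
    linarith
  have huL : ∀ x ∈ s, ∀ y ∈ s, ‖(f x - x) - (f y - y)‖ ≤ (K + 1) * ‖x - y‖ := by
    intro x hx y hy
    have e : (f x - x) - (f y - y) = (f x - f y) - (x - y) := by abel
    rw [e]
    have := norm_sub_le (f x - f y) (x - y)
    have := hf x hx y hy
    linarith
  let p : EuclideanSpace ℝ (Fin n) → EuclideanSpace ℝ (Fin n) := fun x => x + χ x • (f x - x)
  have hqL := lip_smul s χ (fun x => f x - x) 2 1 (K + 1) (1/4) hχL hχ1 huL hclose
  obtain ⟨P, hP0, hpL⟩ : ∃ P : ℝ, 0 ≤ P ∧ ∀ x ∈ s, ∀ y ∈ s, ‖p x - p y‖ ≤ P * ‖x - y‖ := by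
    refine ⟨max 0 (1 + (1 * (K + 1) + 2 * (1/4))), le_max_left _ _, fun x hx y hy => ?_⟩
    have e : p x - p y = (x - y) + (χ x • (f x - x) - χ y • (f y - y)) := by
      simp only [p]; abel
    rw [e]
    calc _ ≤ ‖x - y‖ + ‖χ x • (f x - x) - χ y • (f y - y)‖ := norm_add_le _ _
      _ ≤ ‖x - y‖ + (1 * (K + 1) + 2 * (1/4)) * ‖x - y‖ := by gcongr; exact hqL x hx y hy
      _ = (1 + (1 * (K + 1) + 2 * (1/4))) * ‖x - y‖ := by ring
      _ ≤ _ := by gcongr; exact le_max_right _ _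
  have hpne : ∀ x ∈ s, p x ≠ 0 := by
    intro x hx h0
    by_cases hx2 : ‖x‖ ≤ 1/2
    · have hc : χ x = 1 := min_eq_left (by linarith)
      apply hno x hx
      simpa [p, hc] using h0
    · have e : x = - (χ x • (f x - x)) := eq_neg_of_add_eq_zero_left h0
      have h1 : ‖x‖ ≤ 1/4 := by
        calc ‖x‖ = |χ x| * ‖f x - x‖ := by
              conv_lhs => rw [e]
              rw [norm_neg, norm_smul, Real.norm_eq_abs]
          _ ≤ 1 * (1/4) := by
              gcongr
              · exact hχ1 x hx
              · exact hclose x hx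
          _ = 1/4 := by norm_num
      push Not at hx2
      linarith
  have hpM : ∀ x ∈ s, ‖p x‖ ≤ 5/4 := by
    intro x hx
    calc ‖p x‖ ≤ ‖x‖ + ‖χ x • (f x - x)‖ := norm_add_le _ _
      _ = ‖x‖ + |χ x| * ‖f x - x‖ := by rw [norm_smul, Real.norm_eq_abs]
      _ ≤ 1 + 1 * (1/4) := by
          gcongr
          · exact hx
          · exact hχ1 x hx
          · exact hclose x hx
      _ = _ := by norm_num
  have hpcont : ContinuousOn p s := by
    have : LipschitzOnWith P.toNNReal p s := by
      apply LipschitzOnWith.of_dist_le_mul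
      intro x hx y hy
      rw [dist_eq_norm, dist_eq_norm, Real.coe_toNNReal _ hP0]
      exact hpL x hx y hy
    exact this.continuousOn
  obtain ⟨x0, hx0, hmin⟩ := hs.exists_isMinOn ⟨0, by simp [s]⟩ hpcont.norm
  set m := ‖p x0‖ with hm
  have hmpos : 0 < m := norm_pos_iff.2 (hpne x0 hx0)
  have hmle : ∀ x ∈ s, m ≤ ‖p x‖ := fun x hx => hmin hx
  let a : EuclideanSpace ℝ (Fin n) → ℝ := fun x => ‖p x‖⁻¹
  have haM : ∀ x ∈ s, |a x| ≤ m⁻¹ := by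
    intro x hx
    rw [abs_of_nonneg (by positivity)]
    exact inv_anti₀ hmpos (hmle x hx)
  have haL : ∀ x ∈ s, ∀ y ∈ s, |a x - a y| ≤ (m⁻¹ * m⁻¹ * P) * ‖x - y‖ := by
    intro x hx y hy
    have h1 := lt_of_lt_of_le hmpos (hmle x hx)
    have h2 := lt_of_lt_of_le hmpos (hmle y hy)
    have e : a x - a y = a x * a y * (‖p y‖ - ‖p x‖) := by
      simp only [a]; field_simp
    rw [e, abs_mul, abs_mul, mul_assoc _ P]
    have h3 : |‖p y‖ - ‖p x‖| ≤ P * ‖x - y‖ := by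
      refine (abs_norm_sub_norm_le _ _).trans ?_
      rw [norm_sub_rev]; exact hpL x hx y hy
    gcongr
    · exact haM x hx
    · exact haM y hy
  have hgL := lip_smul s a p _ _ P (5/4) haL haM hpL hpM
  let g : EuclideanSpace ℝ (Fin n) → EuclideanSpace ℝ (Fin n) := fun x => a x • p x
  have hg1 : ∀ x ∈ s, ‖g x‖ = 1 := by
    intro x hx
    have : ‖p x‖ ≠ 0 := norm_ne_zero_iff.2 (hpne x hx)
    simp only [g, a]
    rw [norm_smul, norm_inv, norm_norm, inv_mul_cancel₀ this]
  have hgb : ∀ x, ‖x‖ = 1 → g x = x := by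
    intro x hx
    have hc : χ x = 0 := by simp [χ, hx]
    simp [g, a, p, hc, hx]
  obtain ⟨G, hG0, hGL⟩ : ∃ G : ℝ, 0 ≤ G ∧
      ∀ x ∈ s, ∀ y ∈ s, ‖(g x - x) - (g y - y)‖ ≤ G * ‖x - y‖ := by
    refine ⟨max 0 ((m⁻¹ * P + (m⁻¹ * m⁻¹ * P) * (5/4)) + 1), le_max_left _ _, fun x hx y hy => ?_⟩
    have e : (g x - x) - (g y - y) = (g x - g y) - (x - y) := by abel
    rw [e]
    calc _ ≤ ‖g x - g y‖ + ‖x - y‖ := norm_sub_le _ _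
      _ ≤ (m⁻¹ * P + (m⁻¹ * m⁻¹ * P) * (5/4)) * ‖x - y‖ + ‖x - y‖ := by
          gcongr; exact hgL x hx y hy
      _ = ((m⁻¹ * P + (m⁻¹ * m⁻¹ * P) * (5/4)) + 1) * ‖x - y‖ := by ring
      _ ≤ _ := by gcongr; exact le_max_right _ _
  classical
  let h : EuclideanSpace ℝ (Fin n) → EuclideanSpace ℝ (Fin n) := fun x => if ‖x‖ ≤ 1 then g x - x else 0
  have hin : ∀ x, ‖x‖ ≤ 1 → h x = g x - x := fun x hx => if_pos hx
  have hout : ∀ x, 1 ≤ ‖x‖ → h x = 0 := by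
    intro x hx
    by_cases hx1 : ‖x‖ ≤ 1
    · rw [hin x hx1, hgb x (le_antisymm hx1 hx), sub_self]
    · exact if_neg hx1
  have hmix : ∀ x y, ‖x‖ ≤ 1 → 1 ≤ ‖y‖ → ‖h x - h y‖ ≤ 2 * G * ‖x - y‖ := by
    intro x y hx hy
    have hy0 : 0 < ‖y‖ := by linarith
    let z : EuclideanSpace ℝ (Fin n) := ‖y‖⁻¹ • y
    have hz : ‖z‖ = 1 := by
      simp only [z]; rw [norm_smul, norm_inv, norm_norm, inv_mul_cancel₀ hy0.ne']
    have hyz : ‖y - z‖ = ‖y‖ - 1 := by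
      have e : y - z = (1 - ‖y‖⁻¹) • y := by simp only [z]; rw [sub_smul, one_smul]
      have h1 : 0 ≤ 1 - ‖y‖⁻¹ := sub_nonneg.2 (inv_le_one_of_one_le₀ hy)
      rw [e, norm_smul, Real.norm_of_nonneg h1, sub_mul, one_mul, inv_mul_cancel₀ hy0.ne']
    have hxz : ‖x - z‖ ≤ 2 * ‖x - y‖ := by
      have h1 : ‖x - z‖ ≤ ‖x - y‖ + ‖y - z‖ := norm_sub_le_norm_sub_add_norm_sub _ _ _
      have h2 := norm_sub_norm_le y x
      rw [norm_sub_rev] at h2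
      linarith
    rw [hout y hy, ← hout z hz.ge, hin x hx, hin z hz.le]
    calc _ ≤ G * ‖x - z‖ := hGL x hx z hz.le
      _ ≤ G * (2 * ‖x - y‖) := by gcongr
      _ = _ := by ring
  have hL : LipschitzWith (2 * G).toNNReal h := by
    apply LipschitzWith.of_dist_le_mul
    intro x y
    rw [dist_eq_norm, dist_eq_norm, Real.coe_toNNReal _ (by positivity)]
    rcases le_total ‖x‖ 1 with hx | hx <;> rcases le_total ‖y‖ 1 with hy | hy
    · rw [hin x hx, hin y hy]
      refine (hGL x hx y hy).trans ?_
      gcongr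
      linarith
    · exact hmix x y hx hy
    · rw [norm_sub_rev, norm_sub_rev x]
      exact hmix y x hy hx
    · rw [hout x hx, hout y hy, sub_self, norm_zero]; positivity
  refine no_retraction h _ hL hout fun x hx => ?_
  rw [hin x hx.le, add_sub_cancel]
  exact hg1 x hx.le

end ConicOpen

/-- Conic open-mapping lemma: if a Lipschitz map `F` on `C = B_ρ(0) ∩ ℝ^j_+` with `F(0)=0`
has a conic differential `dF` at `0` (uniformly over bounded sets of the cone) whose image
of `ℝ^j_+` is all of `ℝ^N`, then `0` is an interior point of `F(C)`. -/
theorem stmt_18 (j N : ℕ) (ρ : ℝ) (hρ : 0 < ρ)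
    (F : (Fin j → ℝ) → (Fin N → ℝ)) (K : NNReal)
    (C : Set (Fin j → ℝ)) (hCdef : C = Metric.ball 0 ρ ∩ {η | ∀ i, 0 ≤ η i})
    (hlip : LipschitzOnWith K F C) (hF0 : F 0 = 0)
    (dF : (Fin j → ℝ) →ₗ[ℝ] (Fin N → ℝ))
    (hdiff : ∀ ε > (0:ℝ), ∀ R > (0:ℝ), ∃ δ > (0:ℝ), ∀ α : ℝ, α ∈ Ioo 0 δ →
      ∀ η : Fin j → ℝ, (∀ i, 0 ≤ η i) → ‖η‖ ≤ R → ‖α⁻¹ • F (α • η) - dF η‖ ≤ ε)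
    (hsurj : ∀ y : Fin N → ℝ, ∃ η : Fin j → ℝ, (∀ i, 0 ≤ η i) ∧ dF η = y) :
    (0 : Fin N → ℝ) ∈ interior (F '' C) := by
  choose η hη0 hηd using hsurj
  -- a Lipschitz right inverse of `dF` with values in the cone
  let a : Fin N → Fin j → ℝ := fun i => η (Pi.single i 1)
  let b : Fin N → Fin j → ℝ := fun i => η (-Pi.single i 1)
  let σ : (Fin N → ℝ) → (Fin j → ℝ) := fun y => ∑ i, (max (y i) 0 • a i + max (-y i) 0 • b i)
  let c : ℝ := ∑ i, (‖a i‖ + ‖b i‖)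
  have hc0 : 0 ≤ c := Finset.sum_nonneg fun i _ => by positivity
  have hσd : ∀ y, dF (σ y) = y := by
    intro y
    simp only [σ, map_sum, map_add, map_smul, a, b, hηd]
    have : ∀ i, max (y i) 0 • (Pi.single i 1 : Fin N → ℝ) + max (-y i) 0 • (-Pi.single i 1)
        = Pi.single i (y i) := by
      intro i
      rw [smul_neg, ← sub_eq_add_neg, ← sub_smul]
      have e : max (y i) 0 - max (-y i) 0 = y i := max_zero_sub_max_neg_zero_eq_self (y i)
      rw [e, ← Pi.single_smul, smul_eq_mul, mul_one]
    simp_rw [this]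
    exact Finset.univ_sum_single y
  have hσ0 : ∀ y i, 0 ≤ σ y i := by
    intro y i
    simp only [σ, Finset.sum_apply, Pi.add_apply, Pi.smul_apply, smul_eq_mul]
    refine Finset.sum_nonneg fun k _ => ?_
    have h1 : 0 ≤ a k i := hη0 _ i
    have h2 : 0 ≤ b k i := hη0 _ i
    positivity
  have hσL : ∀ x y, ‖σ x - σ y‖ ≤ c * ‖x - y‖ := by
    intro x y
    simp only [σ]
    rw [← Finset.sum_sub_distrib, Finset.sum_mul]
    refine (norm_sum_le _ _).trans (Finset.sum_le_sum fun i _ => ?_)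
    have e : max (x i) 0 • a i + max (-x i) 0 • b i - (max (y i) 0 • a i + max (-y i) 0 • b i)
        = (max (x i) 0 - max (y i) 0) • a i + (max (-x i) 0 - max (-y i) 0) • b i := by
      rw [sub_smul, sub_smul]; abel
    rw [e]
    have hxy : |x i - y i| ≤ ‖x - y‖ := norm_le_pi_norm (x - y) i
    have h1 : |max (x i) 0 - max (y i) 0| ≤ ‖x - y‖ :=
      (abs_max_sub_max_le_abs _ _ _).trans hxy
    have h2 : |max (-x i) 0 - max (-y i) 0| ≤ ‖x - y‖ := by
      refine (abs_max_sub_max_le_abs _ _ _).trans ?_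
      rw [← abs_neg]
      refine le_trans (le_of_eq ?_) hxy
      congr 1; ring
    calc _ ≤ ‖(max (x i) 0 - max (y i) 0) • a i‖ + ‖(max (-x i) 0 - max (-y i) 0) • b i‖ :=
          norm_add_le _ _
      _ = |max (x i) 0 - max (y i) 0| * ‖a i‖ + |max (-x i) 0 - max (-y i) 0| * ‖b i‖ := by
          rw [norm_smul, norm_smul, Real.norm_eq_abs, Real.norm_eq_abs]
      _ ≤ ‖x - y‖ * ‖a i‖ + ‖x - y‖ * ‖b i‖ := by gcongr
      _ = _ := by ring
  have hσz : σ 0 = 0 := by simp [σ]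
  -- comparison with the Euclidean norm
  let e := EuclideanSpace.equiv (Fin N) ℝ
  obtain ⟨D1, hD1, hb1⟩ := (e : EuclideanSpace ℝ (Fin N) →L[ℝ] (Fin N → ℝ)).bound
  obtain ⟨D2, hD2, hb2⟩ := (e.symm : (Fin N → ℝ) →L[ℝ] EuclideanSpace ℝ (Fin N)).bound
  replace hb1 : ∀ x, ‖e x‖ ≤ D1 * ‖x‖ := hb1
  replace hb2 : ∀ x, ‖e.symm x‖ ≤ D2 * ‖x‖ := hb2
  let R : ℝ := c * D1 + 1
  have hR : 0 < R := by positivity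
  have hσR : ∀ x : EuclideanSpace ℝ (Fin N), ‖x‖ ≤ 1 → ‖σ (e x)‖ ≤ R := by
    intro x hx
    have h1 := hσL (e x) 0
    rw [hσz, sub_zero, sub_zero] at h1
    have h2 : ‖e x‖ ≤ D1 := (hb1 x).trans (by nlinarith)
    have h3 : c * ‖e x‖ ≤ c * D1 := by gcongr
    simp only [R]
    linarith
  obtain ⟨δ, hδ, hd⟩ := hdiff (1 / (8 * D2)) (by positivity) R hR
  let α : ℝ := min (δ / 2) (ρ / (2 * R))
  have hα : 0 < α := by positivity
  have hαδ : α < δ := (min_le_left _ _).trans_lt (by linarith)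
  have hαR : α * R < ρ := by
    have h1 : α * R ≤ ρ / (2 * R) * R := by gcongr; exact min_le_right _ _
    have h2 : ρ / (2 * R) * R = ρ / 2 := by field_simp
    linarith
  have hmem : ∀ x : EuclideanSpace ℝ (Fin N), ‖x‖ ≤ 1 → α • σ (e x) ∈ C := by
    intro x hx
    rw [hCdef]
    refine ⟨?_, fun i => mul_nonneg hα.le (hσ0 _ i)⟩
    rw [mem_ball_zero_iff, norm_smul, Real.norm_of_nonneg hα.le]
    refine lt_of_le_of_lt ?_ hαR
    gcongr
    exact hσR x hx
  rw [mem_interior_iff_mem_nhds]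
  refine Filter.mem_of_superset (Metric.ball_mem_nhds 0 (ε := α / (8 * D2)) (by positivity)) ?_
  intro z hz
  rw [mem_ball_zero_iff] at hz
  obtain ⟨x, hx, hx0⟩ := ConicOpen.exists_zero
    (fun x => e.symm (α⁻¹ • F (α • σ (e x)) - α⁻¹ • z)) (D2 * (α⁻¹ * (K * (α * (c * D1))))) (by
      intro x hx y hy
      rw [← map_sub, sub_sub_sub_cancel_right, ← smul_sub]
      refine (hb2 _).trans ?_
      rw [norm_smul, Real.norm_of_nonneg (by positivity : 0 ≤ α⁻¹)]
      have h1 := hlip.dist_le_mul _ (hmem x hx) _ (hmem y hy)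
      rw [dist_eq_norm, dist_eq_norm, ← smul_sub, norm_smul, Real.norm_of_nonneg hα.le] at h1
      have h2 := hσL (e x) (e y)
      rw [← map_sub] at h2
      have h3 := hb1 (x - y)
      calc _ ≤ D2 * (α⁻¹ * (K * (α * (c * (D1 * ‖x - y‖))))) := by
            gcongr
            refine h1.trans ?_
            gcongr
            refine h2.trans ?_
            gcongr
        _ = _ := by ring) (by
      intro x hx
      have h1 := hd α ⟨hα, hαδ⟩ (σ (e x)) (hσ0 _) (hσR x hx)
      rw [hσd] at h1
      have e1 : e.symm (α⁻¹ • F (α • σ (e x)) - α⁻¹ • z) - x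
          = e.symm ((α⁻¹ • F (α • σ (e x)) - e x) - α⁻¹ • z) := by
        simp only [map_sub, e.symm_apply_apply]; abel
      rw [e1]
      have h2 : ‖α⁻¹ • z‖ ≤ 1 / (8 * D2) := by
        rw [norm_smul, Real.norm_of_nonneg (by positivity : 0 ≤ α⁻¹)]
        calc α⁻¹ * ‖z‖ ≤ α⁻¹ * (α / (8 * D2)) := by gcongr
          _ = _ := by field_simp
      calc _ ≤ D2 * ‖(α⁻¹ • F (α • σ (e x)) - e x) - α⁻¹ • z‖ := hb2 _
        _ ≤ D2 * (1 / (8 * D2) + 1 / (8 * D2)) := by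
            gcongr
            exact (norm_sub_le _ _).trans (add_le_add h1 h2)
        _ = 1 / 4 := by field_simp; norm_num)
  refine ⟨α • σ (e x), hmem x hx, ?_⟩
  have h1 := (map_eq_zero_iff e.symm e.symm.injective).1 hx0
  rw [← smul_sub] at h1
  exact sub_eq_zero.1 ((smul_eq_zero.1 h1).resolve_left (by positivity))
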